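/- arXiv:1906.01296 — 4 statements merged into one kernel-verified Lean document; each statement's English description precedes it below -/
import Mathlib

section
/- Let 𝒱 be a real Hilbert space and 𝒶 : 𝒱×𝒱 → ℝ a bounded bilinear form with 𝒶(v,v) ≥ 0 for all v ∈ 𝒱, satisfying inf_{v∈𝒱} sup_{w∈𝒱} 𝒶(v,w)/(‖v‖_𝒱 ‖w‖_𝒱) ≥ α₀ > 0 and sup_{v∈𝒱} 𝒶(v,w) > 0 for every nonzero w ∈ 𝒱. Let 𝒜, 𝒜_s, 𝒜_a : 𝒱 → 𝒱' be the induced operator and its symmetric and antisymmetric parts, and for t ∈ ℝ set 𝒜_t = 𝒜_a + t𝒜_s. Then for every t ∈ ℝ there exists γ₀(t) > 0 such that for all γ ∈ (0, γ₀(t)) there is β_γ > 0 with 𝒶(v,v) + γ(𝒜v, 𝒜_t v)_{𝒱'} ≥ β_γ ‖v‖_𝒱² for all v ∈ 𝒱. -/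
open scoped RealInnerProductSpace

/-- The Riesz representative of the symmetric part of a nonnegative bounded bilinear form is
controlled by the quadratic form. -/
theorem norm_sq_toDual_symm_symmPart_le
    {V : Type*} [NormedAddCommGroup V] [InnerProductSpace ℝ V] [CompleteSpace V]
    (a : V →L[ℝ] V →L[ℝ] ℝ) (ha : ∀ v : V, 0 ≤ a v v) (v : V) :
    ‖(InnerProductSpace.toDual ℝ V).symm ((2 : ℝ)⁻¹ • (a v + a.flip v))‖ ^ 2
      ≤ (‖a‖ + 1) * a v v := by
  set s := (InnerProductSpace.toDual ℝ V).symm ((2 : ℝ)⁻¹ • (a v + a.flip v)) with hs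
  have hsym : ‖s‖ ^ 2 = 2⁻¹ * (a v s + a s v) := by
    rw [← real_inner_self_eq_norm_sq]
    nth_rewrite 1 [hs]
    rw [InnerProductSpace.toDual_symm_apply]
    simp [mul_add]
  have hbound : a s s ≤ ‖a‖ * ‖s‖ ^ 2 := by
    have := (le_abs_self _).trans (a.le_opNorm₂ s s)
    nlinarith
  have hM : 0 < ‖a‖ + 1 := by positivity
  have hpos := ha ((‖a‖ + 1) • v - s)
  simp only [map_sub, map_smul, sub_apply, smul_apply,
    smul_eq_mul] at hpos
  refine le_of_mul_le_mul_left ?_ hM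
  nlinarith

/-- The inf-sup condition bounds the induced operator from below. -/
theorem mul_norm_le_norm_of_le_sSup
    {V : Type*} [NormedAddCommGroup V] [NormedSpace ℝ V] (f : V →L[ℝ] ℝ) {c : ℝ}
    (h : c ≤ sSup {x : ℝ | ∃ w : V, w ≠ 0 ∧ x = f w / ‖w‖}) : c ≤ ‖f‖ := by
  refine h.trans (Real.sSup_le ?_ (norm_nonneg _))
  rintro x ⟨w, hw, rfl⟩
  rw [div_le_iff₀ (norm_pos_iff.mpr hw)]
  exact (le_abs_self _).trans (f.le_opNorm w)

/-- Theorem 1.1 of the paper, for a single Hilbert space 𝒱.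
`a` is a bounded bilinear form (modelled as a continuous bilinear map) with
`a(v,v) ≥ 0`, satisfying the double inf-sup condition.  The operators
`𝒜v = a v`, `𝒜ₛv = (a v + aᵀ v)/2`, `𝒜ₐv = (a v − aᵀ v)/2` and
`𝒜ₜ = 𝒜ₐ + t𝒜ₛ`.  The dual scalar product is obtained from the Riesz isometry
`InnerProductSpace.toDual`. -/
theorem statement0
    {V : Type*} [NormedAddCommGroup V] [InnerProductSpace ℝ V] [CompleteSpace V]
    (a : V →L[ℝ] V →L[ℝ] ℝ)
    (ha_nonneg : ∀ v : V, 0 ≤ a v v)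
    (α₀ : ℝ) (hα₀ : 0 < α₀)
    (hinfsup : ∀ v : V, α₀ * ‖v‖ ≤ sSup {x : ℝ | ∃ w : V, w ≠ 0 ∧ x = a v w / ‖w‖})
    (hsup : ∀ w : V, w ≠ 0 → ∃ v : V, 0 < a v w) :
    ∀ t : ℝ, ∃ γ₀ : ℝ, 0 < γ₀ ∧ ∀ γ : ℝ, 0 < γ → γ < γ₀ →
      ∃ β : ℝ, 0 < β ∧ ∀ v : V,
        β * ‖v‖ ^ 2 ≤ a v v + γ *
          ⟪(InnerProductSpace.toDual ℝ V).symm (a v),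
            (InnerProductSpace.toDual ℝ V).symm
              (((2 : ℝ)⁻¹ • (a v - a.flip v)) + t • ((2 : ℝ)⁻¹ • (a v + a.flip v)))⟫ := by
  intro t
  have hD : 0 < (t - 1) ^ 2 * (‖a‖ + 1) + 1 := by positivity
  refine ⟨2 / ((t - 1) ^ 2 * (‖a‖ + 1) + 1), by positivity, fun γ hγ hγ' => ?_⟩
  refine ⟨γ * α₀ ^ 2 / 2, by positivity, fun v => ?_⟩
  rw [lt_div_iff₀ hD] at hγ'
  have hsplit : (2 : ℝ)⁻¹ • (a v - a.flip v) + t • ((2 : ℝ)⁻¹ • (a v + a.flip v))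
      = a v + (t - 1) • ((2 : ℝ)⁻¹ • (a v + a.flip v)) := by module
  have hs := norm_sq_toDual_symm_symmPart_le a ha_nonneg v
  rw [hsplit, map_add, map_smul]
  set s := (InnerProductSpace.toDual ℝ V).symm ((2 : ℝ)⁻¹ • (a v + a.flip v))
  have hx : α₀ * ‖v‖ ≤ ‖(InnerProductSpace.toDual ℝ V).symm (a v)‖ := by
    rw [LinearIsometryEquiv.norm_map]
    exact mul_norm_le_norm_of_le_sSup _ (hinfsup v)
  set x := (InnerProductSpace.toDual ℝ V).symm (a v)
  have hx2 : α₀ ^ 2 * ‖v‖ ^ 2 ≤ ‖x‖ ^ 2 := by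
    rw [← mul_pow]
    gcongr
  rw [inner_add_right, real_inner_smul_right, real_inner_self_eq_norm_sq]
  have hyoung : 0 ≤ ‖x‖ ^ 2 + 2 * ((t - 1) * ⟪x, s⟫) + (t - 1) ^ 2 * ‖s‖ ^ 2 := by
    have h := norm_add_sq_real x ((t - 1) • s)
    rw [real_inner_smul_right, norm_smul, mul_pow, Real.norm_eq_abs, sq_abs] at h
    rw [← h]
    positivity
  have hts : (t - 1) ^ 2 * ‖s‖ ^ 2 ≤ (t - 1) ^ 2 * ((‖a‖ + 1) * a v v) := by gcongr
  have hlower : 0 ≤ γ * (‖x‖ ^ 2 + 2 * ((t - 1) * ⟪x, s⟫)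
      + (t - 1) ^ 2 * ((‖a‖ + 1) * a v v) + (‖x‖ ^ 2 - α₀ ^ 2 * ‖v‖ ^ 2)) :=
    mul_nonneg hγ.le (by linarith)
  have hslack := mul_nonneg (sub_nonneg.mpr hγ'.le) (ha_nonneg v)
  have hq := mul_nonneg hγ.le (ha_nonneg v)
  linarith
end

section
/- If the inf-sup condition inf_{p∈H} sup_{v∈V} b(p,v)/(|||p||| ‖v‖) ≥ β > 0 holds, then for any finite-dimensional subspaces Q ⊆ H and W ⊆ V one has ‖B‖⁻¹ inf_{q∈Q} sup_{v∈W} b(q,v)/(|||q||| ‖v‖) ≤ inf_{η∈BQ} sup_{w∈W} ⟨η,w⟩/(‖η‖₋₁ ‖w‖) ≤ β⁻¹ inf_{q∈Q} sup_{v∈W} b(q,v)/(|||q||| ‖v‖), where BQ = {Bq : q ∈ Q} and ‖B‖ denotes the operator norm of B. -/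
theorem sSup_div_norm_nonneg {V : Type*} [NormedAddCommGroup V] [NormedSpace ℝ V]
    (f : V →L[ℝ] ℝ) (W : Submodule ℝ V) :
    0 ≤ sSup {x : ℝ | ∃ w ∈ W, w ≠ 0 ∧ x = f w / ‖w‖} := by
  by_cases h : ∃ w ∈ W, w ≠ 0
  · obtain ⟨w, hw, hw0⟩ := h
    apply Real.sSup_nonneg'
    rcases le_total 0 (f w) with hf | hf
    · exact ⟨f w / ‖w‖, ⟨w, hw, hw0, rfl⟩, by positivity⟩
    · refine ⟨f (-w) / ‖-w‖, ⟨-w, W.neg_mem hw, neg_ne_zero.mpr hw0, rfl⟩, ?_⟩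
      rw [map_neg]
      exact div_nonneg (neg_nonneg.mpr hf) (norm_nonneg _)
  · apply Real.sSup_nonneg
    rintro x ⟨w, hw, hw0, -⟩
    exact (h ⟨w, hw, hw0⟩).elim

theorem sSup_div_norm_le_opNorm {V : Type*} [NormedAddCommGroup V] [NormedSpace ℝ V]
    (f : V →L[ℝ] ℝ) : sSup {x : ℝ | ∃ v : V, v ≠ 0 ∧ x = f v / ‖v‖} ≤ ‖f‖ := by
  refine Real.sSup_le ?_ (norm_nonneg f)
  rintro x ⟨v, -, rfl⟩
  exact div_le_of_le_mul₀ (norm_nonneg v) (norm_nonneg f)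
    ((le_abs_self _).trans (f.le_opNorm v))

/-- Proposition 3.6 of the paper.  If the inf-sup condition
`inf_p sup_v b(p,v)/(|||p|||‖v‖) ≥ β > 0` holds, then for finite-dimensional
subspaces `Q ⊆ H` and `W ⊆ V`,
`‖B‖⁻¹ inf_{q∈Q} sup_{v∈W} b(q,v)/(|||q|||‖v‖)
  ≤ inf_{η∈BQ} sup_{w∈W} ⟨η,w⟩/(‖η‖₋₁‖w‖)
  ≤ β⁻¹ inf_{q∈Q} sup_{v∈W} b(q,v)/(|||q|||‖v‖)`. -/
theorem statement12
    {V : Type*} [NormedAddCommGroup V] [InnerProductSpace ℝ V] [CompleteSpace V]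
    {H : Type*} [NormedAddCommGroup H] [InnerProductSpace ℝ H] [CompleteSpace H]
    (b : H →L[ℝ] V →L[ℝ] ℝ)
    (β : ℝ) (hβ : 0 < β)
    (hinfsup : ∀ p : H, β * ‖p‖ ≤ sSup {x : ℝ | ∃ v : V, v ≠ 0 ∧ x = b p v / ‖v‖})
    (Q : Submodule ℝ H) (hQ : FiniteDimensional ℝ Q)
    (W : Submodule ℝ V) (hW : FiniteDimensional ℝ W) :
    ‖b‖⁻¹ * sInf {y : ℝ | ∃ q ∈ Q, q ≠ 0 ∧
        y = sSup {x : ℝ | ∃ v ∈ W, v ≠ 0 ∧ x = b q v / ‖v‖} / ‖q‖} ≤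
      sInf {y : ℝ | ∃ q ∈ Q, b q ≠ 0 ∧
        y = sSup {x : ℝ | ∃ w ∈ W, w ≠ 0 ∧ x = b q w / ‖w‖} / ‖b q‖} ∧
    sInf {y : ℝ | ∃ q ∈ Q, b q ≠ 0 ∧
        y = sSup {x : ℝ | ∃ w ∈ W, w ≠ 0 ∧ x = b q w / ‖w‖} / ‖b q‖} ≤
      β⁻¹ * sInf {y : ℝ | ∃ q ∈ Q, q ≠ 0 ∧
        y = sSup {x : ℝ | ∃ v ∈ W, v ≠ 0 ∧ x = b q v / ‖v‖} / ‖q‖} := by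
  have hlower (p : H) : β * ‖p‖ ≤ ‖b p‖ := (hinfsup p).trans (sSup_div_norm_le_opNorm (b p))
  have hne {p : H} (hp : p ≠ 0) : b p ≠ 0 :=
    norm_pos_iff.mp ((mul_pos hβ (norm_pos_iff.mpr hp)).trans_le (hlower p))
  have hne' {p : H} (hp : b p ≠ 0) : p ≠ 0 := by
    rintro rfl
    exact hp (map_zero b)
  have hs (q : H) := sSup_div_norm_nonneg (b q) W
  by_cases hQ0 : ∃ q ∈ Q, q ≠ 0
  · obtain ⟨q₀, hq₀, hq₀0⟩ := hQ0
    constructor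
    · refine le_csInf ⟨_, q₀, hq₀, hne hq₀0, rfl⟩ ?_
      rintro y ⟨q, hq, hbq, rfl⟩
      have hq0 : 0 < ‖q‖ := norm_pos_iff.mpr (hne' hbq)
      have hbq0 : 0 < ‖b q‖ := norm_pos_iff.mpr hbq
      have hinf : sInf {y : ℝ | ∃ q ∈ Q, q ≠ 0 ∧
          y = sSup {x : ℝ | ∃ v ∈ W, v ≠ 0 ∧ x = b q v / ‖v‖} / ‖q‖} ≤
          sSup {x : ℝ | ∃ v ∈ W, v ≠ 0 ∧ x = b q v / ‖v‖} / ‖q‖ := by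
        refine csInf_le ⟨0, ?_⟩ ⟨q, hq, hne' hbq, rfl⟩
        rintro y ⟨p, -, -, rfl⟩
        exact div_nonneg (hs p) (norm_nonneg p)
      refine (mul_le_mul_of_nonneg_left hinf (inv_nonneg.mpr (norm_nonneg b))).trans ?_
      rw [inv_mul_eq_div, div_div, mul_comm]
      exact div_le_div_of_nonneg_left (hs q) hbq0 (b.le_opNorm q)
    · rw [← div_eq_inv_mul, le_div_iff₀ hβ]
      refine le_csInf ⟨_, q₀, hq₀, hq₀0, rfl⟩ ?_
      rintro y ⟨q, hq, hq0, rfl⟩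
      have hq0' : 0 < ‖q‖ := norm_pos_iff.mpr hq0
      rw [← le_div_iff₀ hβ, div_div, mul_comm ‖q‖]
      have hinf : sInf {y : ℝ | ∃ q ∈ Q, b q ≠ 0 ∧
          y = sSup {x : ℝ | ∃ w ∈ W, w ≠ 0 ∧ x = b q w / ‖w‖} / ‖b q‖} ≤
          sSup {x : ℝ | ∃ w ∈ W, w ≠ 0 ∧ x = b q w / ‖w‖} / ‖b q‖ := by
        refine csInf_le ⟨0, ?_⟩ ⟨q, hq, hne hq0, rfl⟩
        rintro y ⟨p, -, -, rfl⟩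
        exact div_nonneg (hs p) (norm_nonneg _)
      exact hinf.trans (div_le_div_of_nonneg_left (hs q) (mul_pos hβ hq0') (hlower q))
  · have hA : {y : ℝ | ∃ q ∈ Q, q ≠ 0 ∧
        y = sSup {x : ℝ | ∃ v ∈ W, v ≠ 0 ∧ x = b q v / ‖v‖} / ‖q‖} = ∅ :=
      Set.eq_empty_of_forall_notMem fun _ ⟨q, hq, hq0, _⟩ => hQ0 ⟨q, hq, hq0⟩
    have hB : {y : ℝ | ∃ q ∈ Q, b q ≠ 0 ∧
        y = sSup {x : ℝ | ∃ w ∈ W, w ≠ 0 ∧ x = b q w / ‖w‖} / ‖b q‖} = ∅ :=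
      Set.eq_empty_of_forall_notMem fun _ ⟨q, hq, hbq, _⟩ => hQ0 ⟨q, hq, hne' hbq⟩
    simp [hA, hB]
end

section
/- Let s : V×V → ℝ be a bilinear form satisfying s(v,w) ≤ K⋆‖v‖‖w‖ and s(v,v) ≥ κ⋆‖v‖² for all v,w ∈ V. There exists γ̃₀ > 0 (namely γ̃₀ = 2κ⋆α/‖A‖²) such that for all 0 < γ < γ̃₀ the problem — find (u,w,p) ∈ V×V×H such that a(u,v) + (1/γ)s(w,z) + a(u,z) − b(p,v+z) + b(q,u+w) = ⟨F, v+z⟩ + ⟨G,q⟩ for all (v,z,q) ∈ V×V×H — admits the unique solution (u⁰, 0, p⁰), where (u⁰,p⁰) is the solution of the saddle point problem a(u⁰,v) − b(p⁰,v) + b(q,u⁰) = ⟨F,v⟩ + ⟨G,q⟩ for all (v,q) ∈ V×H. -/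
/-- If `b` is bounded below in the inf-sup sense, then `b p` determines `p`. -/
theorem eq_zero_of_infSup
    {V : Type*} [NormedAddCommGroup V] [NormedSpace ℝ V]
    {H : Type*} [NormedAddCommGroup H] [NormedSpace ℝ H]
    {b : H →L[ℝ] V →L[ℝ] ℝ} {β : ℝ} (hβ : 0 < β)
    (hinfsup : ∀ p : H, β * ‖p‖ ≤ sSup {x : ℝ | ∃ v : V, v ≠ 0 ∧ x = b p v / ‖v‖})
    {p : H} (hp : ∀ v, b p v = 0) : p = 0 := by
  have hle : β * ‖p‖ ≤ 0 := (hinfsup p).trans <| Real.sSup_nonpos <| by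
    rintro x ⟨v, -, rfl⟩
    simp [hp v]
  exact norm_le_zero_iff.1 (nonpos_of_mul_nonpos_right hle hβ)

/-- A bilinear form bounded below by `c * ‖v‖ ^ 2` on the diagonal with `c > 0` is definite. -/
theorem eq_zero_of_coercive_of_nonpos
    {V : Type*} [NormedAddCommGroup V] [NormedSpace ℝ V]
    {a : V →L[ℝ] V →L[ℝ] ℝ} {c : ℝ} (hc : 0 < c)
    (ha : ∀ v : V, c * ‖v‖ ^ 2 ≤ a v v) {v : V} (hv : a v v ≤ 0) : v = 0 := by
  have h : ‖v‖ ^ 2 ≤ 0 := nonpos_of_mul_nonpos_right ((ha v).trans hv) hc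
  exact norm_eq_zero.1 (pow_eq_zero_iff two_ne_zero |>.1 (le_antisymm h (sq_nonneg _)))

/-- For every `γ > 0`, the augmented saddle point problem has `(u0, 0, p0)` as its only solution,
where `(u0, p0)` solves the original saddle point problem. -/
theorem augmented_saddlePoint_iff
    {V : Type*} [NormedAddCommGroup V] [NormedSpace ℝ V]
    {H : Type*} [NormedAddCommGroup H] [NormedSpace ℝ H]
    {a : V →L[ℝ] V →L[ℝ] ℝ} {b : H →L[ℝ] V →L[ℝ] ℝ}
    {α : ℝ} (hα : 0 < α) (hcoerc : ∀ u : V, α * ‖u‖ ^ 2 ≤ a u u)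
    {β : ℝ} (hβ : 0 < β)
    (hinfsup : ∀ p : H, β * ‖p‖ ≤ sSup {x : ℝ | ∃ v : V, v ≠ 0 ∧ x = b p v / ‖v‖})
    {s : V →L[ℝ] V →L[ℝ] ℝ} {κ : ℝ} (hκ : 0 < κ)
    (hs_coer : ∀ v : V, κ * ‖v‖ ^ 2 ≤ s v v)
    {F : V →L[ℝ] ℝ} {G : H →L[ℝ] ℝ} {u0 : V} {p0 : H}
    (hsol : ∀ (v : V) (q : H), a u0 v - b p0 v + b q u0 = F v + G q)
    {γ : ℝ} (hγ : 0 < γ) (uwp : V × V × H) :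
    (∀ (v z : V) (q : H),
        a uwp.1 v + (1 / γ) * s uwp.2.1 z + a uwp.1 z
          - b uwp.2.2 (v + z) + b q (uwp.1 + uwp.2.1)
          = F (v + z) + G q) ↔
      uwp = (u0, 0, p0) := by
  obtain ⟨u, w, p⟩ := uwp
  constructor
  · intro h
    simp only [map_add] at h
    have hsw : 1 / γ * s w w = 0 := by
      have h₁ := h w 0 0
      have h₂ := h 0 w 0
      simp only [map_zero, zero_apply] at h₁ h₂
      linarith
    have hw : w = 0 := eq_zero_of_coercive_of_nonpos hκ hs_coer
      ((mul_eq_zero.1 hsw).resolve_left (one_div_pos.2 hγ).ne').le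
    subst hw
    have hmom : ∀ v, a (u - u0) v = b (p - p0) v := fun v ↦ by
      have h₁ := h v 0 0
      have h₂ := hsol v 0
      simp only [map_zero, map_sub, zero_apply, sub_apply] at h₁ h₂ ⊢
      linarith
    have hdiv : ∀ q, b q (u - u0) = 0 := fun q ↦ by
      have h₁ := h 0 0 q
      have h₂ := hsol 0 q
      simp only [map_zero, map_sub] at h₁ h₂ ⊢
      linarith
    have hu : u - u0 = 0 := eq_zero_of_coercive_of_nonpos hα hcoerc
      ((hmom _).trans (hdiv _)).le
    have hp : p - p0 = 0 := eq_zero_of_infSup hβ hinfsup fun v ↦ by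
      rw [← hmom v, hu, map_zero, zero_apply]
    rw [sub_eq_zero.1 hu, sub_eq_zero.1 hp]
  · intro h v z q
    obtain ⟨rfl, rfl, rfl⟩ : u = u0 ∧ w = 0 ∧ p = p0 := by simpa using h
    have h₁ := hsol (v + z) q
    simp only [map_add, map_zero, zero_apply] at h₁ ⊢
    linarith

/-- Proposition 3.8 of the paper.  Let `s` be a bounded
bilinear form on `V × V` with `s(v,w) ≤ K⋆‖v‖‖w‖` and `s(v,v) ≥ κ⋆‖v‖²`.
There is `γ̃₀ = 2κ⋆α/‖A‖² > 0` such that for all `0 < γ < γ̃₀` the augmented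
problem (3.12) admits the unique solution `(u⁰, 0, p⁰)`, where `(u⁰,p⁰)` solves
the saddle point problem (1.1). -/
theorem statement14
    {V : Type*} [NormedAddCommGroup V] [InnerProductSpace ℝ V] [CompleteSpace V]
    {H : Type*} [NormedAddCommGroup H] [InnerProductSpace ℝ H] [CompleteSpace H]
    (a : V →L[ℝ] V →L[ℝ] ℝ) (b : H →L[ℝ] V →L[ℝ] ℝ)
    (α : ℝ) (hα : 0 < α)
    (hcoerc : ∀ u : V, α * ‖u‖ ^ 2 ≤ a u u)
    (β : ℝ) (hβ : 0 < β)
    (hinfsup : ∀ p : H, β * ‖p‖ ≤ sSup {x : ℝ | ∃ v : V, v ≠ 0 ∧ x = b p v / ‖v‖})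
    (s : V →L[ℝ] V →L[ℝ] ℝ)
    (Kstar κstar : ℝ) (hκ : 0 < κstar) (hKκ : κstar ≤ Kstar)
    (hs_bdd : ∀ v w : V, s v w ≤ Kstar * ‖v‖ * ‖w‖)
    (hs_coer : ∀ v : V, κstar * ‖v‖ ^ 2 ≤ s v v)
    (F : V →L[ℝ] ℝ) (G : H →L[ℝ] ℝ) (u0 : V) (p0 : H)
    (hsol : ∀ (v : V) (q : H), a u0 v - b p0 v + b q u0 = F v + G q) :
    (∃ γ₀ : ℝ, 0 < γ₀ ∧
      ∀ γ : ℝ, 0 < γ → γ < γ₀ →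
        ∀ uwp : V × V × H,
          ((∀ (v z : V) (q : H),
              a uwp.1 v + (1 / γ) * s uwp.2.1 z + a uwp.1 z
                - b uwp.2.2 (v + z) + b q (uwp.1 + uwp.2.1)
                = F (v + z) + G q) ↔
            uwp = (u0, 0, p0))) ∧
    -- namely, one may take `γ̃₀ = 2κ⋆α/‖A‖²`:
    ∀ γ : ℝ, 0 < γ → γ < 2 * κstar * α / ‖a‖ ^ 2 →
      ∀ uwp : V × V × H,
        ((∀ (v z : V) (q : H),
            a uwp.1 v + (1 / γ) * s uwp.2.1 z + a uwp.1 z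
              - b uwp.2.2 (v + z) + b q (uwp.1 + uwp.2.1)
              = F (v + z) + G q) ↔
          uwp = (u0, 0, p0)) := by
  exact ⟨⟨1, one_pos, fun γ hγ _ ↦
      augmented_saddlePoint_iff hα hcoerc hβ hinfsup hκ hs_coer hsol hγ⟩,
    fun γ hγ _ ↦ augmented_saddlePoint_iff hα hcoerc hβ hinfsup hκ hs_coer hsol hγ⟩
end

section
/- Let s : V×V → ℝ be a bilinear form satisfying s(v,w) ≤ K⋆‖v‖‖w‖ and s(v,v) ≥ κ⋆‖v‖² for all v,w ∈ V. Then for every 0 < γ < 2κ⋆α/‖A‖² and all u, w ∈ V, one has a(u,u) + a(u,w) + (1/γ)s(w,w) ≥ α̌_γ (‖u‖² + ‖w‖²), where α̌_γ = min{ α/2, κ⋆/γ − ‖A‖²/(2α) } > 0. -/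
/-- the coercivity estimate in the proof of Proposition 3.8 of
the paper.  Let `s` be a bounded bilinear form on `V × V` with
`s(v,w) ≤ K⋆‖v‖‖w‖` and `s(v,v) ≥ κ⋆‖v‖²`.  Then for every
`0 < γ < 2κ⋆α/‖A‖²` and all `u,w ∈ V`,
`a(u,u) + a(u,w) + (1/γ)s(w,w) ≥ α̌_γ(‖u‖² + ‖w‖²)` with
`α̌_γ = min{α/2, κ⋆/γ − ‖A‖²/(2α)} > 0`. -/
theorem statement15
    {V : Type*} [NormedAddCommGroup V] [InnerProductSpace ℝ V] [CompleteSpace V]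
    (a : V →L[ℝ] V →L[ℝ] ℝ)
    (α : ℝ) (hα : 0 < α)
    (hcoerc : ∀ u : V, α * ‖u‖ ^ 2 ≤ a u u)
    (s : V →L[ℝ] V →L[ℝ] ℝ)
    (Kstar κstar : ℝ) (hκ : 0 < κstar) (hKκ : κstar ≤ Kstar)
    (hs_bdd : ∀ v w : V, s v w ≤ Kstar * ‖v‖ * ‖w‖)
    (hs_coer : ∀ v : V, κstar * ‖v‖ ^ 2 ≤ s v v) :
    ∀ γ : ℝ, 0 < γ → γ < 2 * κstar * α / ‖a‖ ^ 2 →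
      0 < min (α / 2) (κstar / γ - ‖a‖ ^ 2 / (2 * α)) ∧
      ∀ u w : V,
        min (α / 2) (κstar / γ - ‖a‖ ^ 2 / (2 * α)) * (‖u‖ ^ 2 + ‖w‖ ^ 2) ≤
          a u u + a u w + (1 / γ) * s w w := by
  intro γ hγ hγlt
  have hA : 0 < ‖a‖ ^ 2 := by
    refine lt_of_le_of_ne (sq_nonneg _) fun h => ?_
    rw [← h, div_zero] at hγlt
    exact hγ.not_gt hγlt
  refine ⟨lt_min (half_pos hα) ?_, fun u w => ?_⟩
  · rw [lt_div_iff₀ hA] at hγlt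
    rw [sub_pos, div_lt_div_iff₀ (by positivity) hγ]
    linarith
  · have hcross : -(α / 2 * ‖u‖ ^ 2 + ‖a‖ ^ 2 / (2 * α) * ‖w‖ ^ 2) ≤ a u w := by
      have hyoung : α / 2 * ‖u‖ ^ 2 + ‖a‖ ^ 2 / (2 * α) * ‖w‖ ^ 2 - ‖a‖ * ‖u‖ * ‖w‖ =
          (α * ‖u‖ - ‖a‖ * ‖w‖) ^ 2 / (2 * α) := by
        field_simp
        ring
      have hsq : 0 ≤ (α * ‖u‖ - ‖a‖ * ‖w‖) ^ 2 / (2 * α) := by positivity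
      have hbound : -(‖a‖ * ‖u‖ * ‖w‖) ≤ a u w :=
        (abs_le.mp (a.le_opNorm₂ u w)).1
      linarith
    have hs : κstar / γ * ‖w‖ ^ 2 ≤ 1 / γ * s w w := by
      have h := mul_le_mul_of_nonneg_left (hs_coer w) (one_div_pos.mpr hγ).le
      calc κstar / γ * ‖w‖ ^ 2 = 1 / γ * (κstar * ‖w‖ ^ 2) := by ring
        _ ≤ 1 / γ * s w w := h
    have hu := mul_le_mul_of_nonneg_right
      (min_le_left (α / 2) (κstar / γ - ‖a‖ ^ 2 / (2 * α))) (sq_nonneg ‖u‖)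
    have hw := mul_le_mul_of_nonneg_right
      (min_le_right (α / 2) (κstar / γ - ‖a‖ ^ 2 / (2 * α))) (sq_nonneg ‖w‖)
    linarith [hcoerc u]
end
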